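/- Let n be a positive integer and let p₀,…,pₙ ∈ ℝ^{1,n} be (n+1) points in general position. Then the Lorentzian distance-squared mapping L_{(p₀,…,pₙ)} : ℝ^{1,n} → ℝ^{n+1} is A-equivalent to the mapping (x₀,…,xₙ) ↦ (x₁,…,xₙ, x₀x₁) if and only if the recognition subspace V(p₀,…,pₙ) is light-like. -/

import Mathlib

open scoped BigOperators

noncomputable section

/-- The Lorentzian inner product on `ℝ^{1,n}`, modeled as `Fin (n+1) → ℝ`:
`⟨x,y⟩ = -x₀y₀ + x₁y₁ + ⋯ + xₙyₙ`. -/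
def lorIP {n : ℕ} (x y : Fin (n + 1) → ℝ) : ℝ :=
  (∑ i, x i * y i) - 2 * (x 0 * y 0)

/-- The Euclidean inner product on `Fin m → ℝ`. -/
def eucIP {m : ℕ} (x y : Fin m → ℝ) : ℝ := ∑ i, x i * y i

/-- The Lorentzian distance-squared mapping determined by the points `p 0, …, p (m-1)`. -/
def LorDSM {n m : ℕ} (p : Fin m → Fin (n + 1) → ℝ) :
    (Fin (n + 1) → ℝ) → (Fin m → ℝ) :=
  fun x i => lorIP (x - p i) (x - p i)

/-- The Euclidean distance-squared mapping determined by the points `p 0, …, p (m-1)`. -/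
def EucDSM {n m : ℕ} (p : Fin m → Fin (n + 1) → ℝ) :
    (Fin (n + 1) → ℝ) → (Fin m → ℝ) :=
  fun x i => eucIP (x - p i) (x - p i)

/-- The recognition subspace `V(p₀, …, p_k)`: the span of the vectors `p i - p 0`. -/
def recSub {n k : ℕ} (p : Fin (k + 1) → Fin (n + 1) → ℝ) :
    Submodule ℝ (Fin (n + 1) → ℝ) :=
  Submodule.span ℝ (Set.range fun i => p i - p 0)

/-- The partial recognition subspace `V(p₀, …, p_j)`: the span of `p i - p 0` for `i ≤ j`. -/
def recSubUpTo {n k : ℕ} (p : Fin (k + 1) → Fin (n + 1) → ℝ) (j : ℕ) :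
    Submodule ℝ (Fin (n + 1) → ℝ) :=
  Submodule.span ℝ {v | ∃ i : Fin (k + 1), (i : ℕ) ≤ j ∧ v = p i - p 0}

/-- A subspace is time-like iff it contains a vector of negative Lorentzian square. -/
def LTimeLike {n : ℕ} (V : Submodule ℝ (Fin (n + 1) → ℝ)) : Prop :=
  ∃ v ∈ V, lorIP v v < 0

/-- A subspace is space-like iff every nonzero vector in it has positive Lorentzian square. -/
def LSpaceLike {n : ℕ} (V : Submodule ℝ (Fin (n + 1) → ℝ)) : Prop :=
  ∀ v ∈ V, v ≠ 0 → 0 < lorIP v v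

/-- A subspace is light-like iff it is neither time-like nor space-like. -/
def LLightLike {n : ℕ} (V : Submodule ℝ (Fin (n + 1) → ℝ)) : Prop :=
  ¬ LTimeLike V ∧ ¬ LSpaceLike V

/-- `f` and `g` are `𝒜`-equivalent: `g = H ∘ f ∘ h` for `C^∞` diffeomorphisms `h, H`. -/
def AEquiv {a b : ℕ} (f g : (Fin a → ℝ) → (Fin b → ℝ)) : Prop :=
  ∃ (h : (Fin a → ℝ) ≃ (Fin a → ℝ)) (H : (Fin b → ℝ) ≃ (Fin b → ℝ)),
    ContDiff ℝ (⊤ : ℕ∞) ⇑h ∧ ContDiff ℝ (⊤ : ℕ∞) ⇑h.symm ∧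
    ContDiff ℝ (⊤ : ℕ∞) ⇑H ∧ ContDiff ℝ (⊤ : ℕ∞) ⇑H.symm ∧
    g = ⇑H ∘ f ∘ ⇑h

/-- The Lorentzian inner product as a bilinear form. -/
def lorForm (n : ℕ) : LinearMap.BilinForm ℝ (Fin (n + 1) → ℝ) :=
  LinearMap.mk₂ ℝ lorIP
    (fun x y z => by simp only [lorIP, Pi.add_apply, add_mul, Finset.sum_add_distrib]; ring)
    (fun c x y => by
      simp only [lorIP, Pi.smul_apply, smul_eq_mul, mul_assoc, ← Finset.mul_sum]; ring)
    (fun x y z => by simp only [lorIP, Pi.add_apply, mul_add, Finset.sum_add_distrib]; ring)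
    (fun c x y => by
      simp only [lorIP, Pi.smul_apply, smul_eq_mul, mul_left_comm, ← Finset.mul_sum]; ring)

theorem lorForm_apply {n : ℕ} (x y : Fin (n + 1) → ℝ) : lorForm n x y = lorIP x y := rfl

theorem lorIP_comm {n : ℕ} (x y : Fin (n + 1) → ℝ) : lorIP x y = lorIP y x := by
  simp only [lorIP, mul_comm]

theorem lorIP_eq_sum_succ {n : ℕ} (x y : Fin (n + 1) → ℝ) :
    lorIP x y = (∑ i : Fin n, x i.succ * y i.succ) - x 0 * y 0 := by
  rw [lorIP, Fin.sum_univ_succ]; ring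

theorem lorIP_add_add {n : ℕ} (x y : Fin (n + 1) → ℝ) :
    lorIP (x + y) (x + y) = lorIP x x + 2 * lorIP x y + lorIP y y := by
  simp only [← lorForm_apply, map_add, LinearMap.add_apply]
  simp only [lorForm_apply, lorIP_comm y x]; ring

theorem lorIP_sub_sub {n : ℕ} (x y : Fin (n + 1) → ℝ) :
    lorIP (x - y) (x - y) = lorIP x x - 2 * lorIP x y + lorIP y y := by
  simp only [← lorForm_apply, map_sub, LinearMap.sub_apply]
  simp only [lorForm_apply, lorIP_comm y x]; ring

theorem lorIP_smul_right {n : ℕ} (c : ℝ) (x y : Fin (n + 1) → ℝ) :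
    lorIP x (c • y) = c * lorIP x y := by
  simp only [← lorForm_apply, map_smul, smul_eq_mul]

theorem lorIP_smul_left {n : ℕ} (c : ℝ) (x y : Fin (n + 1) → ℝ) :
    lorIP (c • x) y = c * lorIP x y := by
  rw [lorIP_comm, lorIP_smul_right, lorIP_comm]

theorem lorForm_isRefl (n : ℕ) : (lorForm n).IsRefl := fun x y h => by
  rwa [lorForm_apply, lorIP_comm]

theorem lorForm_nondegenerate (n : ℕ) : (lorForm n).Nondegenerate := by
  have key : ∀ x : Fin (n + 1) → ℝ, (∀ y, lorIP x y = 0) → x = 0 := by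
    intro x hx
    funext i
    have h := hx (Pi.single i 1)
    by_cases hi : i = 0
    · subst hi
      simp only [lorIP_eq_sum_succ, Pi.single_eq_same, Pi.single_eq_of_ne (Fin.succ_ne_zero _),
        mul_zero, Finset.sum_const_zero, mul_one, zero_sub, neg_eq_zero] at h
      exact h
    · simpa [lorIP, Pi.single_apply, Ne.symm hi, hi] using h
  exact ⟨key, fun x hx => key x fun y => by rw [lorIP_comm]; exact hx y⟩

theorem eq_zero_of_lorIP_self_nonpos {n : ℕ} {u : Fin (n + 1) → ℝ} (hu : lorIP u u ≤ 0)
    (h0 : u 0 = 0) : u = 0 := by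
  rw [lorIP_eq_sum_succ, h0] at hu
  have hs : ∑ i : Fin n, u i.succ * u i.succ = 0 :=
    le_antisymm (by linarith) (Finset.sum_nonneg fun i _ => mul_self_nonneg _)
  rw [Finset.sum_eq_zero_iff_of_nonneg fun i _ => mul_self_nonneg _] at hs
  funext i
  refine Fin.cases h0 (fun j => ?_) i
  exact mul_self_eq_zero.1 (hs j (Finset.mem_univ _))

/-- A causal vector orthogonal to a time-like vector vanishes. -/
theorem eq_zero_of_lorIP_eq_zero {n : ℕ} {u v : Fin (n + 1) → ℝ} (hv : lorIP v v < 0)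
    (hu : lorIP u u ≤ 0) (huv : lorIP u v = 0) : u = 0 := by
  refine eq_zero_of_lorIP_self_nonpos hu ?_
  by_contra h0
  rw [lorIP_eq_sum_succ] at hv hu huv
  have hcs := Finset.sum_mul_sq_le_sq_mul_sq Finset.univ (fun i : Fin n => u i.succ)
    (fun i : Fin n => v i.succ)
  simp only [sq] at hcs
  have hpos : 0 < u 0 * u 0 := mul_self_pos.2 h0
  have hnn : 0 ≤ ∑ i : Fin n, v i.succ * v i.succ :=
    Finset.sum_nonneg fun i _ => mul_self_nonneg _
  have huv' : ∑ i : Fin n, u i.succ * v i.succ = u 0 * v 0 := by linarith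
  rw [huv'] at hcs
  nlinarith [mul_le_mul_of_nonneg_right (sub_nonpos.1 hu) hnn,
    mul_lt_mul_of_pos_left (sub_neg.1 hv) hpos]

theorem finrank_orthogonal_recSub {n : ℕ} {p : Fin (n + 1) → Fin (n + 1) → ℝ}
    (hgen : Module.finrank ℝ (recSub p) = n) :
    Module.finrank ℝ ((lorForm n).orthogonal (recSub p)) = 1 := by
  rw [LinearMap.BilinForm.finrank_orthogonal (lorForm_nondegenerate n), hgen]; simp

theorem exists_smul_eq_of_mem_orthogonal {n : ℕ} {p : Fin (n + 1) → Fin (n + 1) → ℝ}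
    (hgen : Module.finrank ℝ (recSub p) = n) {u w : Fin (n + 1) → ℝ} (hu0 : u ≠ 0)
    (hu : u ∈ (lorForm n).orthogonal (recSub p)) (hw : w ∈ (lorForm n).orthogonal (recSub p)) :
    ∃ c : ℝ, c • u = w := by
  obtain ⟨c, hc⟩ := (finrank_eq_one_iff_of_nonzero' (⟨u, hu⟩ : (lorForm n).orthogonal (recSub p))
    (by simpa [Subtype.ext_iff] using hu0)).1 (finrank_orthogonal_recSub hgen) ⟨w, hw⟩
  exact ⟨c, congrArg Subtype.val hc⟩

theorem LorDSM_apply_eq {n m : ℕ} (p : Fin (m + 1) → Fin (n + 1) → ℝ) (x : Fin (n + 1) → ℝ)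
    (i : Fin (m + 1)) :
    LorDSM p x i = lorIP (x - p 0) (x - p 0) - 2 * lorIP (x - p 0) (p i - p 0) +
      lorIP (p i - p 0) (p i - p 0) := by
  rw [LorDSM, ← lorIP_sub_sub, sub_sub_sub_cancel_right]

/-- Two points in the same fibre differ by a vector orthogonal to the recognition subspace. -/
theorem sub_mem_orthogonal_of_LorDSM_eq {n m : ℕ} {p : Fin (m + 1) → Fin (n + 1) → ℝ}
    {a b : Fin (n + 1) → ℝ} (h : LorDSM p a = LorDSM p b) :
    b - a ∈ (lorForm n).orthogonal (recSub p) := by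
  have hspan : recSub p ≤ LinearMap.ker (lorForm n (b - a)) := by
    refine Submodule.span_le.2 ?_
    rintro _ ⟨i, rfl⟩
    have hi := congrFun h i
    have h0 := congrFun h 0
    simp only [LorDSM] at h0
    rw [LorDSM_apply_eq, LorDSM_apply_eq] at hi
    have hlin : lorIP (b - a) (p i - p 0) =
        lorIP (b - p 0) (p i - p 0) - lorIP (a - p 0) (p i - p 0) := by
      rw [← lorForm_apply, ← sub_sub_sub_cancel_right b a (p 0), map_sub (lorForm n)]; rfl
    change lorIP (b - a) (p i - p 0) = 0
    linarith
  intro v hv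
  change lorIP v (b - a) = 0
  rw [lorIP_comm]
  exact hspan hv

/-- A fibre of the distance-squared mapping with three points forces a light-like
recognition subspace. -/
theorem LLightLike_of_three_points {n : ℕ} {p : Fin (n + 1) → Fin (n + 1) → ℝ}
    (hgen : Module.finrank ℝ (recSub p) = n) {a b c : Fin (n + 1) → ℝ}
    (hab : a ≠ b) (hac : a ≠ c) (hbc : b ≠ c) (hLb : LorDSM p a = LorDSM p b)
    (hLc : LorDSM p a = LorDSM p c) : LLightLike (recSub p) := by
  have hu := sub_mem_orthogonal_of_LorDSM_eq hLb
  have hu0 : b - a ≠ 0 := sub_ne_zero.2 hab.symm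
  obtain ⟨t, ht⟩ := exists_smul_eq_of_mem_orthogonal hgen hu0 hu
    (sub_mem_orthogonal_of_LorDSM_eq hLc)
  have ht0 : t ≠ 0 := by
    rintro rfl
    exact hac (sub_eq_zero.1 (by rw [← ht, zero_smul])).symm
  have ht1 : t ≠ 1 := by
    rintro rfl
    rw [one_smul] at ht
    exact hbc (sub_left_injective ht)
  have hb := congrFun hLb 0
  have hc := congrFun hLc 0
  simp only [LorDSM] at hb hc
  rw [show b - p 0 = (a - p 0) + (b - a) by abel, lorIP_add_add (a - p 0)] at hb
  rw [show c - p 0 = (a - p 0) + t • (b - a) by rw [ht]; abel, lorIP_add_add (a - p 0),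
    lorIP_smul_right, lorIP_smul_right, lorIP_smul_left] at hc
  have hnull : lorIP (b - a) (b - a) = 0 := by
    have : t * (t - 1) * lorIP (b - a) (b - a) = 0 := by linear_combination t * hb - hc
    simpa [ht0, sub_ne_zero.2 ht1] using this
  have horth : ∀ v ∈ recSub p, lorIP v (b - a) = 0 := hu
  constructor
  · rintro ⟨v, hv, hvneg⟩
    exact hu0 (eq_zero_of_lorIP_eq_zero hvneg hnull.le (by rw [lorIP_comm]; exact horth v hv))
  · intro hs
    have hmem : b - a ∈ recSub p := by
      rw [← LinearMap.BilinForm.orthogonal_orthogonal (lorForm_nondegenerate n) (lorForm_isRefl n)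
        (recSub p)]
      intro w hw
      obtain ⟨s, rfl⟩ := exists_smul_eq_of_mem_orthogonal hgen hu0 hu hw
      change lorIP (s • (b - a)) (b - a) = 0
      rw [lorIP_smul_left, hnull, mul_zero]
    exact (hs _ hmem hu0).ne' hnull

/-- A light-like subspace contains a nonzero null vector orthogonal to the whole subspace. -/
theorem exists_null_of_LLightLike {n : ℕ} {V : Submodule ℝ (Fin (n + 1) → ℝ)}
    (hV : LLightLike V) :
    ∃ e ∈ V, e ≠ 0 ∧ ∀ v ∈ V, lorIP v e = 0 := by
  obtain ⟨htime, hspace⟩ := hV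
  simp only [LTimeLike, not_exists, not_and, not_lt] at htime
  simp only [LSpaceLike, not_forall, not_lt] at hspace
  obtain ⟨e, heV, he0, hele⟩ := hspace
  have hnull : lorIP e e = 0 := le_antisymm hele (htime e heV)
  refine ⟨e, heV, he0, fun v hv => ?_⟩
  by_contra hne
  have h := htime (v + (-(lorIP v v + 1) / (2 * lorIP v e)) • e)
    (V.add_mem hv (V.smul_mem _ heV))
  rw [lorIP_add_add, lorIP_smul_right, lorIP_smul_right, lorIP_smul_left, hnull] at h
  have hc : -(lorIP v v + 1) / (2 * lorIP v e) * lorIP v e = -(lorIP v v + 1) / 2 := by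
    field_simp
  rw [hc] at h
  linarith

/-- The vectors `p i - p 0` with `i ≠ 0` span the recognition subspace. -/
theorem exists_basis_recSub {n : ℕ} {p : Fin (n + 1) → Fin (n + 1) → ℝ}
    (hgen : Module.finrank ℝ (recSub p) = n) :
    ∃ b : Module.Basis (Fin n) ℝ (recSub p),
      ∀ i, (b i : Fin (n + 1) → ℝ) = p i.succ - p 0 := by
  have hmem : ∀ i, p i - p 0 ∈ recSub p := fun i => Submodule.subset_span ⟨i, rfl⟩
  let v : Fin n → recSub p := fun i => ⟨p i.succ - p 0, hmem _⟩
  have hspan : ⊤ ≤ Submodule.span ℝ (Set.range v) := by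
    have hle : recSub p ≤ (Submodule.span ℝ (Set.range v)).map (recSub p).subtype := by
      refine Submodule.span_le.2 ?_
      rintro _ ⟨i, rfl⟩
      refine Fin.cases ?_ (fun j => ?_) i
      · simp
      · exact ⟨v j, Submodule.subset_span ⟨j, rfl⟩, rfl⟩
    rintro ⟨x, hx⟩ -
    obtain ⟨y, hy, hyx⟩ := hle hx
    rwa [show (⟨x, hx⟩ : recSub p) = y from Subtype.ext hyx.symm]
  refine ⟨basisOfTopLeSpanOfCardEqFinrank v hspan (by simp [hgen]), fun i => ?_⟩
  simp [v]

/-- Linear coordinates adapted to a null vector `e` spanning the radical of a light-like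
hyperplane: the pairings with a basis of the hyperplane, and a multiple of the time coordinate. -/
theorem exists_null_coordinates {n : ℕ} {p : Fin (n + 1) → Fin (n + 1) → ℝ}
    (hgen : Module.finrank ℝ (recSub p) = n) (b : Module.Basis (Fin n) ℝ (recSub p))
    {e : Fin (n + 1) → ℝ} (he : e ∈ recSub p) (he0 : e ≠ 0)
    (horth : ∀ v ∈ recSub p, lorIP v e = 0) :
    ∃ A : (Fin (n + 1) → ℝ) ≃ₗ[ℝ] (Fin (n + 1) → ℝ),
      (∀ x j, A x (Fin.succ j) = lorIP x (b j)) ∧ A e = Fin.cons 2 0 := by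
  have hez : e 0 ≠ 0 := fun h => he0 (eq_zero_of_lorIP_self_nonpos (horth e he).le h)
  let A₀ : (Fin (n + 1) → ℝ) →ₗ[ℝ] (Fin (n + 1) → ℝ) :=
    LinearMap.pi (Fin.cons ((2 / e 0) • LinearMap.proj 0) fun j => (lorForm n).flip (b j))
  have hA0 : ∀ x, A₀ x 0 = 2 / e 0 * x 0 := fun x => by simp [A₀]
  have hAs : ∀ x (j : Fin n), A₀ x j.succ = lorIP x (b j) := fun x j => by
    simp [A₀, lorForm_apply]
  have hinj : Function.Injective A₀ := by
    rw [← LinearMap.ker_eq_bot, LinearMap.ker_eq_bot']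
    intro x hx
    have hxo : x ∈ (lorForm n).orthogonal (recSub p) := by
      have hz : (lorForm n x).comp (recSub p).subtype = 0 := b.ext fun j => by
        simpa [lorForm_apply, hx] using (hAs x j).symm
      intro v hv
      change lorIP v x = 0
      rw [lorIP_comm]
      exact LinearMap.congr_fun hz ⟨v, hv⟩
    obtain ⟨c, rfl⟩ := exists_smul_eq_of_mem_orthogonal hgen he0 (show _ from horth) hxo
    have h0 := hA0 (c • e)
    rw [hx] at h0
    simp [hez] at h0
    simp [h0]
  refine ⟨LinearEquiv.ofInjectiveEndo A₀ hinj, fun x j => hAs x j, ?_⟩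
  funext i
  refine Fin.cases ?_ (fun j => ?_) i
  · simp [hA0, hez]
  · simp [hAs, lorIP_comm e, horth]

theorem exists_basis_apply_eq {V : Type*} [NormedAddCommGroup V] [NormedSpace ℝ V] {ι : Type*}
    (b : Module.Basis ι ℝ V) (i : ι) {e : V} (he : e ≠ 0) :
    ∃ b' : Module.Basis ι ℝ V, b' i = e := by
  obtain ⟨f, hf⟩ := SeparatingDual.exists_continuousLinearEquiv_apply_eq (R := ℝ) (b.ne_zero i) he
  exact ⟨b.map f.toLinearEquiv, by simpa using hf⟩

theorem contDiff_lorIP_self {n : ℕ} {E : Type*} [NormedAddCommGroup E] [NormedSpace ℝ E]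
    {f : E → Fin (n + 1) → ℝ} (hf : ContDiff ℝ (⊤ : ℕ∞) f) :
    ContDiff ℝ (⊤ : ℕ∞) fun x => lorIP (f x) (f x) := by
  rw [contDiff_pi] at hf
  unfold lorIP
  fun_prop

/-- The target diffeomorphism: recover the linear coordinates from differences of squared
distances, then subtract a function of them. -/
def targetEquiv {n : ℕ} (C : (Fin n → ℝ) ≃ₗ[ℝ] (Fin n → ℝ)) (d : Fin n → ℝ)
    (q : (Fin n → ℝ) → ℝ) : (Fin (n + 1) → ℝ) ≃ (Fin (n + 1) → ℝ) where
  toFun y := Fin.snoc (α := fun _ => ℝ) (C fun i => (y 0 - y i.succ + d i) / 2)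
    (y 0 - q (C fun i => (y 0 - y i.succ + d i) / 2))
  invFun z := Fin.cons (α := fun _ => ℝ) (z (Fin.last n) + q fun j => z j.castSucc)
    fun i => (z (Fin.last n) + q fun j => z j.castSucc) + d i - 2 * C.symm (fun j => z j.castSucc) i
  left_inv y := by
    funext i
    refine Fin.cases ?_ (fun j => ?_) i
    · simp
    · simp; ring
  right_inv z := by
    have h : (fun i => (z (Fin.last n) + q (fun j => z j.castSucc) -
        (z (Fin.last n) + q (fun j => z j.castSucc) + d i -
          2 * C.symm (fun j => z j.castSucc) i) + d i) / 2) = C.symm fun j => z j.castSucc := by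
      funext i; ring
    funext i
    simp only [Fin.cons_zero, Fin.cons_succ, h, LinearEquiv.apply_symm_apply]
    refine Fin.lastCases ?_ (fun j => ?_) i <;> simp

theorem contDiff_linearEquiv {m : ℕ} {E : Type*} [NormedAddCommGroup E] [NormedSpace ℝ E]
    {l : ℕ} (C : (Fin m → ℝ) ≃ₗ[ℝ] (Fin l → ℝ)) {f : E → Fin m → ℝ}
    (hf : ContDiff ℝ (⊤ : ℕ∞) f) : ContDiff ℝ (⊤ : ℕ∞) fun x => C (f x) :=
  C.toContinuousLinearEquiv.contDiff.comp hf

theorem contDiff_targetEquiv {n : ℕ} (C : (Fin n → ℝ) ≃ₗ[ℝ] (Fin n → ℝ)) (d : Fin n → ℝ)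
    {q : (Fin n → ℝ) → ℝ} (hq : ContDiff ℝ (⊤ : ℕ∞) q) :
    ContDiff ℝ (⊤ : ℕ∞) (targetEquiv C d q) := by
  have hC : ContDiff ℝ (⊤ : ℕ∞) fun y : Fin (n + 1) → ℝ =>
      C fun i => (y 0 - y i.succ + d i) / 2 := contDiff_linearEquiv C (by fun_prop)
  refine contDiff_pi.2 fun i => ?_
  refine Fin.lastCases ?_ (fun j => ?_) i
  · simp only [targetEquiv, Equiv.coe_fn_mk, Fin.snoc_last]
    exact (contDiff_apply ℝ ℝ 0).sub (hq.comp hC)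
  · simp only [targetEquiv, Equiv.coe_fn_mk, Fin.snoc_castSucc]
    exact contDiff_pi.1 hC j

theorem contDiff_targetEquiv_symm {n : ℕ} (C : (Fin n → ℝ) ≃ₗ[ℝ] (Fin n → ℝ)) (d : Fin n → ℝ)
    {q : (Fin n → ℝ) → ℝ} (hq : ContDiff ℝ (⊤ : ℕ∞) q) :
    ContDiff ℝ (⊤ : ℕ∞) (targetEquiv C d q).symm := by
  have hinit : ContDiff ℝ (⊤ : ℕ∞) fun (z : Fin (n + 1) → ℝ) (j : Fin n) => z j.castSucc := by
    fun_prop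
  have h0 : ContDiff ℝ (⊤ : ℕ∞) fun z : Fin (n + 1) → ℝ =>
      z (Fin.last n) + q fun j => z j.castSucc := (contDiff_apply ℝ ℝ _).add (hq.comp hinit)
  refine contDiff_pi.2 fun i => ?_
  refine Fin.cases h0 (fun j => ?_) i
  exact (h0.add contDiff_const).sub
    (contDiff_const.mul (contDiff_pi.1 (contDiff_linearEquiv C.symm hinit) j))

theorem theorem1_2b (n : ℕ) (hn : 1 ≤ n)
    (p : Fin (n + 1) → Fin (n + 1) → ℝ)
    (hgen : Module.finrank ℝ (recSub p) = n) :
    AEquiv (LorDSM p)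
        (fun (x : Fin (n + 1) → ℝ) (i : Fin (n + 1)) =>
          if h : (i : ℕ) < n then x ⟨(i : ℕ) + 1, by omega⟩
          else x 0 * x ⟨1, by omega⟩)
      ↔ LLightLike (recSub p) := by
  constructor
  · rintro ⟨h, H, -, -, -, -, hg⟩
    have hfib : ∀ t : ℝ, LorDSM p (h (Pi.single 0 t)) = LorDSM p (h (Pi.single 0 0)) := by
      intro t
      apply H.injective
      have h1 := congrFun hg (Pi.single 0 t)
      have h2 := congrFun hg (Pi.single 0 0)
      simp only [Function.comp_apply] at h1 h2
      rw [← h1, ← h2]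
      funext i
      have hz : ∀ (k : ℕ) (hk : k + 1 < n + 1) (s : ℝ),
          (Pi.single 0 s : Fin (n + 1) → ℝ) ⟨k + 1, hk⟩ = 0 := fun k hk s => by
        simp [Fin.ext_iff]
      split_ifs with hi
      · rw [hz, hz]
      · have h1 : ∀ s : ℝ, (Pi.single 0 s : Fin (n + 1) → ℝ) ⟨1, by omega⟩ = 0 := hz 0 (by omega)
        rw [h1, h1, mul_zero, mul_zero]
    have hne : ∀ s t : ℝ, s ≠ t → h (Pi.single 0 s) ≠ h (Pi.single 0 t) := fun s t hst heq =>
      hst (Pi.single_injective (M := fun _ : Fin (n + 1) => ℝ) 0 (h.injective heq))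
    exact LLightLike_of_three_points hgen (hne 0 1 (by norm_num)) (hne 0 2 (by norm_num))
      (hne 1 2 (by norm_num)) (hfib 1).symm (hfib 2).symm
  · intro hlight
    obtain ⟨m, rfl⟩ : ∃ m, n = m + 1 := ⟨n - 1, by omega⟩
    obtain ⟨e, he, he0, horth⟩ := exists_null_of_LLightLike hlight
    obtain ⟨b, hb⟩ := exists_basis_recSub hgen
    obtain ⟨b', hb'⟩ := exists_basis_apply_eq b 0
      (show (⟨e, he⟩ : recSub p) ≠ 0 by simpa [Subtype.ext_iff] using he0)
    obtain ⟨A, hA, hAe⟩ := exists_null_coordinates hgen b' he he0 horth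
    let C : (Fin (m + 1) → ℝ) ≃ₗ[ℝ] (Fin (m + 1) → ℝ) := b.constr ℝ ≪≫ₗ (b'.constr ℝ).symm
    have hC : ∀ x, C (fun i => lorIP x (p i.succ - p 0)) = fun j => lorIP x (b' j) := by
      intro x
      have hx : b.constr ℝ (fun i => lorIP x (p i.succ - p 0)) =
          (lorForm (m + 1) x).comp (recSub p).subtype := b.ext fun i => by
        simp [hb, lorForm_apply]
      change (b'.constr ℝ).symm (b.constr ℝ _) = _
      rw [hx, LinearEquiv.symm_apply_eq]
      refine b'.ext fun j => ?_
      simp [lorForm_apply]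
    let lift : (Fin (m + 1) → ℝ) → Fin (m + 2) → ℝ := fun w =>
      A.symm (Fin.cons (α := fun _ => ℝ) 0 w)
    let q : (Fin (m + 1) → ℝ) → ℝ := fun w => lorIP (lift w) (lift w)
    have hq : ContDiff ℝ (⊤ : ℕ∞) q := by
      refine contDiff_lorIP_self (contDiff_linearEquiv A.symm (contDiff_pi.2 fun i => ?_))
      exact Fin.cases (by simpa using contDiff_const) (fun j => by simpa using contDiff_apply ℝ ℝ j) i
    have hsq : ∀ x : Fin (m + 2) → ℝ,
        lorIP (A.symm x) (A.symm x) = x 0 * x 1 + q (Fin.tail x) := by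
      intro x
      have hdecomp : A.symm x = lift (Fin.tail x) + (x 0 / 2) • e := by
        rw [LinearEquiv.symm_apply_eq, map_add, map_smul, hAe, LinearEquiv.apply_symm_apply]
        funext i
        refine Fin.cases ?_ (fun j => ?_) i <;> simp [Fin.tail]
      have hlift : lorIP (lift (Fin.tail x)) e = x 1 := by
        have h0 := hA (lift (Fin.tail x)) 0
        rw [hb', LinearEquiv.apply_symm_apply] at h0
        exact h0.symm
      rw [hdecomp, lorIP_add_add, lorIP_smul_right, lorIP_smul_right, lorIP_smul_left, hlift,
        horth e he]
      ring
    refine ⟨A.symm.toEquiv.trans (Equiv.addRight (p 0)),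
      targetEquiv C (fun i => lorIP (p i.succ - p 0) (p i.succ - p 0)) q, ?_, ?_,
      contDiff_targetEquiv _ _ hq, contDiff_targetEquiv_symm _ _ hq, ?_⟩
    · exact (contDiff_linearEquiv A.symm contDiff_id).add contDiff_const
    · exact contDiff_linearEquiv A (contDiff_id.sub contDiff_const)
    · funext x
      have hlin : (fun i : Fin (m + 1) => (LorDSM p (A.symm x + p 0) 0 -
          LorDSM p (A.symm x + p 0) i.succ + lorIP (p i.succ - p 0) (p i.succ - p 0)) / 2) =
          fun i => lorIP (A.symm x) (p i.succ - p 0) := by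
        funext i
        rw [LorDSM_apply_eq p _ i.succ, LorDSM, add_sub_cancel_right]
        ring
      have hw : C (fun i => lorIP (A.symm x) (p i.succ - p 0)) = Fin.tail x := by
        rw [hC]
        funext j
        rw [← hA, LinearEquiv.apply_symm_apply]
        rfl
      have h0 : LorDSM p (A.symm x + p 0) 0 = x 0 * x 1 + q (Fin.tail x) := by
        rw [LorDSM, add_sub_cancel_right, hsq]
      change _ = Fin.snoc (α := fun _ => ℝ) (C fun i => (LorDSM p (A.symm x + p 0) 0 -
          LorDSM p (A.symm x + p 0) i.succ + lorIP (p i.succ - p 0) (p i.succ - p 0)) / 2)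
        (LorDSM p (A.symm x + p 0) 0 - q (C fun i => (LorDSM p (A.symm x + p 0) 0 -
          LorDSM p (A.symm x + p 0) i.succ + lorIP (p i.succ - p 0) (p i.succ - p 0)) / 2))
      rw [hlin, hw, h0, add_sub_cancel_right]
      funext i
      refine Fin.lastCases ?_ (fun j => ?_) i
      · simp
      · simp only [Fin.snoc_castSucc, Fin.val_castSucc, j.isLt, dif_pos]
        rfl
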